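/- Let L ⊆ A* be the set of all words in shortlex normal form (i.e., shortlex-least in their π-fiber). Then the set of left-hand sides of U-minimal rules, i.e., {u : ∃ v, (u,v) is a U-minimal rule}, is equal to (L·A ∩ A·L) \ L, where L·A = {wx : w ∈ L, x ∈ A} and A·L = {xw : x ∈ A, w ∈ L}. -/

import Mathlib

/-- The shortlex order on words: `u < v` iff `u` is shorter, or of equal length
and lexicographically smaller. -/
def ShortLexLt {A : Type} [LinearOrder A] (u v : List A) : Prop :=
  u.length < v.length ∨ (u.length = v.length ∧ List.Lex (· < ·) u v)

/-- An elementary `R`-reduction: replace an occurrence of a left-hand side of a rule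
of `R` as a subword by the corresponding right-hand side. -/
def ElemRed {A : Type} (R : Set (List A × List A)) (u v : List A) : Prop :=
  ∃ a b lam rho : List A, (lam, rho) ∈ R ∧ u = a ++ lam ++ b ∧ v = a ++ rho ++ b

/-- A word is `R`-irreducible if no elementary `R`-reduction applies to it. -/
def Irred {A : Type} (R : Set (List A × List A)) (u : List A) : Prop :=
  ¬ ∃ v : List A, ElemRed R u v

/-- The standard assumptions on a set of rules `R`: every rule `(u,v)` satisfies
`u > v` in shortlex and `π u = π v`, and Thue equivalence (the equivalence relation
generated by elementary `R`-reductions) coincides with equality of `π`-images. -/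
def StandardAssumptions {A G : Type} [LinearOrder A] (π : List A → G)
    (R : Set (List A × List A)) : Prop :=
  (∀ p ∈ R, ShortLexLt p.2 p.1 ∧ π p.1 = π p.2) ∧
  (∀ u v : List A, Relation.EqvGen (ElemRed R) u v ↔ π u = π v)

/-- `R` is confluent if all `R`-irreducible words obtainable from a given word by
sequences of elementary `R`-reductions are equal. -/
def Confluent {A : Type} (R : Set (List A × List A)) : Prop :=
  ∀ w u v : List A, Relation.ReflTransGen (ElemRed R) w u →
    Relation.ReflTransGen (ElemRed R) w v → Irred R u → Irred R v → u = v

/-- `u` is the shortlex normal form of its `π`-image: it is shortlex-least in its `π`-fiber. -/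
def IsShortLexNF {A G : Type} [LinearOrder A] (π : List A → G) (u : List A) : Prop :=
  ∀ v : List A, π v = π u → u = v ∨ ShortLexLt u v

/-- The universal set of rules: all pairs `(u,v)` with `u > v` in shortlex and `π u = π v`. -/
def URules {A G : Type} [LinearOrder A] (π : List A → G) : Set (List A × List A) :=
  {p | ShortLexLt p.2 p.1 ∧ π p.1 = π p.2}

/-- `s` is a proper (contiguous) subword of `u`. -/
def ProperFactor {A : Type} (s u : List A) : Prop :=
  ∃ a b : List A, u = a ++ s ++ b ∧ a ++ b ≠ []

/-- A rule `(u,v)` is `R`-minimal if `v` is `R`-irreducible and every proper subword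
of `u` is `R`-irreducible. -/
def RMinimal {A : Type} (R : Set (List A × List A)) (p : List A × List A) : Prop :=
  Irred R p.2 ∧ ∀ s : List A, ProperFactor s p.1 → Irred R s

/-- The set of `U`-minimal rules. -/
def UMinRules {A G : Type} [LinearOrder A] (π : List A → G) : Set (List A × List A) :=
  {p | p ∈ URules π ∧ RMinimal (URules π) p}

theorem List.Lex.append_right_of_length_eq {r : A → A → Prop} {u v : List A}
    (h : List.Lex r u v) (hlen : u.length = v.length) (b : List A) :
    List.Lex r (u ++ b) (v ++ b) := by
  induction h with
  | nil => simp at hlen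
  | rel h => exact .rel h
  | cons _ ih => exact .cons (ih (by simpa using hlen))

section ShortLex

variable {A : Type} [LinearOrder A]

theorem shortLexLt_iff_shortlex {u v : List A} :
    ShortLexLt u v ↔ List.Shortlex (· < ·) u v :=
  List.shortlex_def.symm

theorem shortLexLt_wellFounded [Finite A] : WellFounded (ShortLexLt (A := A)) := by
  have h : ShortLexLt (A := A) = List.Shortlex (· < ·) := by
    funext u v
    exact propext shortLexLt_iff_shortlex
  rw [h]
  exact List.Shortlex.wf wellFounded_lt

theorem ShortLexLt.asymm {u v : List A} (huv : ShortLexLt u v) : ¬ ShortLexLt v u := by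
  rintro (hvu | ⟨hlen, hvu⟩)
  · rcases huv with huv | ⟨h, -⟩ <;> omega
  · rcases huv with huv | ⟨-, huv⟩
    · omega
    · exact _root_.asymm (r := List.Lex (· < ·)) huv hvu

theorem ShortLexLt.irrefl (u : List A) : ¬ ShortLexLt u u :=
  fun h => h.asymm h

theorem shortLexLt_trichotomy (u v : List A) : ShortLexLt u v ∨ u = v ∨ ShortLexLt v u := by
  rcases lt_trichotomy u.length v.length with h | h | h
  · exact .inl (.inl h)
  · rcases trichotomous_of (List.Lex (· < ·)) u v with h' | h' | h'
    · exact .inl (.inr ⟨h, h'⟩)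
    · exact .inr (.inl h')
    · exact .inr (.inr (.inr ⟨h.symm, h'⟩))
  · exact .inr (.inr (.inl h))

theorem ShortLexLt.append {u v : List A} (h : ShortLexLt u v) (a b : List A) :
    ShortLexLt (a ++ u ++ b) (a ++ v ++ b) := by
  rcases h with h | ⟨hlen, h⟩
  · left
    simp only [List.length_append]
    omega
  · refine .inr ⟨by simp [hlen], ?_⟩
    rw [List.append_assoc, List.append_assoc]
    exact List.Lex.append_left _ (h.append_right_of_length_eq hlen b) a

end ShortLex

theorem Irred.of_append {A : Type} {R : Set (List A × List A)} {a s b : List A}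
    (h : Irred R (a ++ s ++ b)) : Irred R s := by
  rintro ⟨_, c, d, lam, rho, hR, rfl, rfl⟩
  exact h ⟨_, a ++ c, d ++ b, lam, rho, hR, by simp, rfl⟩

section NormalForm

variable {A G : Type} [LinearOrder A] {π : List A → G}

theorem IsShortLexNF.not_shortLexLt {u v : List A} (h : IsShortLexNF π u) (hv : π v = π u) :
    ¬ ShortLexLt v u := by
  intro hlt
  rcases h v hv with rfl | h
  · exact ShortLexLt.irrefl _ hlt
  · exact h.asymm hlt

theorem isShortLexNF_of_irred {u : List A} (h : Irred (URules π) u) : IsShortLexNF π u := by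
  intro v hv
  rcases shortLexLt_trichotomy u v with h' | h' | h'
  · exact .inr h'
  · exact .inl h'
  · exact absurd ⟨v, [], [], u, v, ⟨h', hv.symm⟩, by simp, by simp⟩ h

theorem exists_isShortLexNF [Finite A] (π : List A → G) (u : List A) :
    ∃ v, π v = π u ∧ IsShortLexNF π v := by
  obtain ⟨v, hv, hmin⟩ := shortLexLt_wellFounded.has_min {v | π v = π u} ⟨u, rfl⟩
  refine ⟨v, hv, fun w hw => ?_⟩
  rcases shortLexLt_trichotomy v w with h | h | h
  · exact .inr h
  · exact .inl h
  · exact absurd h (hmin w (hw.trans hv))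

theorem irred_uRules_iff [Mul G] (hπ_mul : ∀ u v : List A, π (u ++ v) = π u * π v)
    {u : List A} : Irred (URules π) u ↔ IsShortLexNF π u := by
  refine ⟨isShortLexNF_of_irred, fun h => ?_⟩
  rintro ⟨_, a, b, lam, rho, ⟨hlt, heq⟩, rfl, rfl⟩
  refine h.not_shortLexLt ?_ (hlt.append a b)
  simp only [hπ_mul, show π lam = π rho from heq]

end NormalForm

/-- Writing `L` for the set of shortlex normal forms, the set of left-hand
sides of `U`-minimal rules equals `(L·A ∩ A·L) \ L`. -/
theorem stmt8 {A G : Type} [Fintype A] [LinearOrder A] [Group G]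
    (π : List A → G) (hπ_nil : π [] = 1)
    (hπ_mul : ∀ u v : List A, π (u ++ v) = π u * π v)
    (hπ_surj : Function.Surjective π)
    (ι : A → A) (hι : Function.Involutive ι)
    (hι_inv : ∀ x : A, π [ι x] = (π [x])⁻¹) :
    {u : List A | ∃ v : List A, (u, v) ∈ UMinRules π} =
      ({w : List A | ∃ u : List A, IsShortLexNF π u ∧ ∃ x : A, w = u ++ [x]} ∩
       {w : List A | ∃ x : A, ∃ u : List A, IsShortLexNF π u ∧ w = x :: u}) \
      {u : List A | IsShortLexNF π u} := by
  ext u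
  simp only [Set.mem_ofPred_eq, Set.mem_sdiff, Set.mem_inter_iff]
  constructor
  · rintro ⟨v, ⟨hlt, heq⟩, -, hfac⟩
    have hnf : ¬ IsShortLexNF π u := fun h => h.not_shortLexLt heq.symm hlt
    have hne : u ≠ [] := by
      rintro rfl
      rcases hlt with h | ⟨-, h⟩
      · simp at h
      · cases h
    refine ⟨⟨⟨u.dropLast, ?_, u.getLast hne, (List.dropLast_append_getLast hne).symm⟩,
      ⟨u.head hne, u.tail, ?_, (List.cons_head_tail hne).symm⟩⟩, hnf⟩
    · exact isShortLexNF_of_irred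
        (hfac _ ⟨[], [u.getLast hne], (List.dropLast_append_getLast hne).symm, by simp⟩)
    · exact isShortLexNF_of_irred
        (hfac _ ⟨[u.head hne], [], by simp, by simp⟩)
  · rintro ⟨⟨⟨p, hp, y, hpy⟩, x, q, hq, hxq⟩, hnf⟩
    obtain ⟨v, hv, hvnf⟩ := exists_isShortLexNF π u
    have hlt : ShortLexLt v u := by
      rcases hvnf u hv.symm with rfl | h
      · exact absurd hvnf hnf
      · exact h
    refine ⟨v, ⟨hlt, hv.symm⟩, (irred_uRules_iff hπ_mul).2 hvnf, ?_⟩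
    rintro s ⟨a, b, hs, hab⟩
    rcases a with _ | ⟨c, a⟩
    · obtain ⟨b, z, rfl⟩ := List.eq_nil_or_concat' b |>.resolve_left (by simpa using hab)
      have hps : p = [] ++ s ++ b := by
        have h : p ++ [y] = ([] ++ s ++ b) ++ [z] := by
          rw [← hpy, List.append_assoc _ b]
          exact hs
        exact (List.append_inj' h rfl).1
      exact Irred.of_append (hps ▸ (irred_uRules_iff hπ_mul).2 hp)
    · have hqs : q = a ++ s ++ b := by
        simpa using (List.cons.inj (hxq.symm.trans hs)).2
      exact Irred.of_append (hqs ▸ (irred_uRules_iff hπ_mul).2 hq)
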